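/- Let ε ∈ (0,1) and let X ∈ ℝ^{n×p} satisfy ‖XᵀX − I_p‖_F ≤ ε. Let T ∈ ℝ^{n×p} satisfy sym(XᵀT) = 0, let N := −(1/2)X(XᵀX − I_p), and let Λ := T + N with Λ ≠ 0. Set g := ‖Λ‖_F and d := ‖XᵀX − I_p‖_F. If 0 < η ≤ min{ ((1/2)d(1−d) + √((1/4)d²(1−d)² + g²(ε−d))) / g² , 1 }, then ‖(X+ηΛ)ᵀ(X+ηΛ) − I_p‖_F ≤ ε. -/

import Mathlib

open Matrix BigOperators

noncomputable section

/-- Frobenius norm of a real matrix. -/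
def frob {m k : ℕ} (A : Matrix (Fin m) (Fin k) ℝ) : ℝ :=
  Real.sqrt (∑ i, ∑ j, (A i j) ^ 2)

/-- Symmetric part of a square matrix. -/
def symPart {m : ℕ} (A : Matrix (Fin m) (Fin m) ℝ) : Matrix (Fin m) (Fin m) ℝ :=
  (1 / 2 : ℝ) • (A + Aᵀ)

section FrobeniusNorm

open scoped Matrix.Norms.Frobenius

lemma frob_eq_norm {m k : ℕ} (A : Matrix (Fin m) (Fin k) ℝ) : frob A = ‖A‖ := by
  simp [frob, Matrix.frobenius_norm_def, Real.sqrt_eq_rpow]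

lemma frob_smul_add_smul_add_smul_le {m : ℕ} (a b c : ℝ) (A B C : Matrix (Fin m) (Fin m) ℝ) :
    frob (a • A + b • B + c • C) ≤ |a| * frob A + |b| * frob B + |c| * frob C := by
  simp only [frob_eq_norm]
  refine norm_add₃_le.trans_eq ?_
  simp only [norm_smul, Real.norm_eq_abs]

lemma frob_mul_le {l m k : ℕ} (A : Matrix (Fin l) (Fin m) ℝ) (B : Matrix (Fin m) (Fin k) ℝ) :
    frob (A * B) ≤ frob A * frob B := by
  simpa only [frob_eq_norm] using Matrix.frobenius_norm_mul A B

lemma frob_transpose {m k : ℕ} (A : Matrix (Fin m) (Fin k) ℝ) : frob Aᵀ = frob A := by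
  simpa only [frob_eq_norm] using Matrix.frobenius_norm_transpose A

lemma frob_pos {m k : ℕ} {A : Matrix (Fin m) (Fin k) ℝ} (hA : A ≠ 0) : 0 < frob A := by
  simpa only [frob_eq_norm] using norm_pos_iff.2 hA

end FrobeniusNorm

/-- A tangent component plus the order-1 Newton–Schulz normal component changes the
orthogonality defect `E = XᵀX − I` by a quadratic term and a second-order remainder. -/
lemma orthogonality_defect_step {n p : ℕ} {X T Λ : Matrix (Fin n) (Fin p) ℝ}
    (hT : symPart (Xᵀ * T) = 0)
    (hΛ : Λ = T + -((1 / 2 : ℝ) • (X * (Xᵀ * X - 1)))) (η : ℝ) :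
    (X + η • Λ)ᵀ * (X + η • Λ) - 1 =
      (1 - η) • (Xᵀ * X - 1) + (-η) • ((Xᵀ * X - 1) * (Xᵀ * X - 1)) + η ^ 2 • (Λᵀ * Λ) := by
  have hT' : Xᵀ * T + Tᵀ * X = 0 := by
    simpa only [symPart, Matrix.transpose_mul, Matrix.transpose_transpose] using
      (smul_eq_zero.1 hT).resolve_left (by norm_num)
  obtain ⟨E, hE⟩ : ∃ E, E = Xᵀ * X - 1 := ⟨_, rfl⟩
  have hXX : Xᵀ * X = E + 1 := by simp [hE]
  have hEt : Eᵀ = E := by simp [hE]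
  rw [← hE] at hΛ ⊢
  have hS : Xᵀ * Λ + Λᵀ * X = -E - E * E := by
    have h1 : Xᵀ * Λ = Xᵀ * T - (1 / 2 : ℝ) • ((E + 1) * E) := by
      rw [hΛ, Matrix.mul_add, Matrix.mul_neg, Matrix.mul_smul, ← Matrix.mul_assoc, hXX,
        sub_eq_add_neg]
    have h2 : Λᵀ * X = Tᵀ * X - (1 / 2 : ℝ) • (E * (E + 1)) := by
      rw [hΛ, Matrix.transpose_add, Matrix.transpose_neg, Matrix.transpose_smul,
        Matrix.transpose_mul, hEt, Matrix.add_mul, Matrix.neg_mul, Matrix.smul_mul,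
        Matrix.mul_assoc, hXX, sub_eq_add_neg]
    rw [h1, h2, sub_add_sub_comm, hT', add_mul, mul_add, one_mul, mul_one]
    module
  have hexp : (X + η • Λ)ᵀ * (X + η • Λ) =
      Xᵀ * X + η • (Xᵀ * Λ + Λᵀ * X) + η ^ 2 • (Λᵀ * Λ) := by
    simp only [Matrix.transpose_add, Matrix.transpose_smul, Matrix.add_mul, Matrix.mul_add,
      Matrix.smul_mul, Matrix.mul_smul]
    module
  rw [hexp, hS, hXX]
  module

/-- A nonnegative number below the larger root of `a x² − 2 b x − c`, with `a > 0` and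
`c ≥ 0`, makes the quadratic nonpositive. -/
lemma quadratic_le_of_le_root {a b c x : ℝ} (ha : 0 < a) (hc : 0 ≤ c) (hx : 0 ≤ x)
    (h : x ≤ (b + √(b ^ 2 + a * c)) / a) : a * x ^ 2 ≤ 2 * b * x + c := by
  rw [le_div_iff₀ ha] at h
  have hs : √(b ^ 2 + a * c) ^ 2 = b ^ 2 + a * c := Real.sq_sqrt (by positivity)
  have hb : b ≤ √(b ^ 2 + a * c) := Real.le_sqrt_of_sq_le (by nlinarith [mul_nonneg ha.le hc])
  have hxa : 0 ≤ x * a := by positivity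
  refine le_of_mul_le_mul_left ?_ ha
  nlinarith [mul_nonneg (sub_nonneg.2 h)
    (show 0 ≤ x * a - b + √(b ^ 2 + a * c) by linarith)]

/-- Safeguard step size: with a tangent component `T`, the order-1 Newton–Schulz normal
component `N = −(1/2)X(XᵀX−I)`, and `Λ = T + N ≠ 0`, any step size
`0 < η ≤ min{((1/2)d(1−d) + √((1/4)d²(1−d)² + g²(ε−d)))/g², 1}` keeps the iterate in the
safe region `St(p,n)^ε`. -/
theorem safe_step_size {n p : ℕ} (ε : ℝ) (hε : ε ∈ Set.Ioo (0 : ℝ) 1)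
    (X T : Matrix (Fin n) (Fin p) ℝ)
    (hX : frob (Xᵀ * X - 1) ≤ ε)
    (hT : symPart (Xᵀ * T) = 0)
    (N Λ : Matrix (Fin n) (Fin p) ℝ)
    (hN : N = -((1 / 2 : ℝ) • (X * (Xᵀ * X - 1))))
    (hΛ : Λ = T + N) (hΛ0 : Λ ≠ 0)
    (g d : ℝ) (hg : g = frob Λ) (hd : d = frob (Xᵀ * X - 1))
    (η : ℝ) (hη0 : 0 < η)
    (hη : η ≤ min ((1 / 2 * d * (1 - d) +
        Real.sqrt (1 / 4 * d ^ 2 * (1 - d) ^ 2 + g ^ 2 * (ε - d))) / g ^ 2) 1) :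
    frob ((X + η • Λ)ᵀ * (X + η • Λ) - 1) ≤ ε := by
  obtain ⟨hη₁, hη1⟩ := le_min_iff.1 hη
  subst hN
  have hdε : d ≤ ε := hd ▸ hX
  have hg0 : 0 < g := hg ▸ frob_pos hΛ0
  have hquad : g ^ 2 * η ^ 2 ≤ 2 * (1 / 2 * d * (1 - d)) * η + (ε - d) := by
    refine quadratic_le_of_le_root (by positivity) (sub_nonneg.2 hdε) hη0.le ?_
    rwa [show (1 / 2 * d * (1 - d)) ^ 2 = 1 / 4 * d ^ 2 * (1 - d) ^ 2 by ring]
  have hEE := frob_mul_le (Xᵀ * X - 1) (Xᵀ * X - 1)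
  have hΛΛ := frob_mul_le Λᵀ Λ
  rw [frob_transpose, ← hg] at hΛΛ
  rw [← hd] at hEE
  rw [orthogonality_defect_step hT hΛ]
  calc _ ≤ |1 - η| * d + |-η| * (d * d) + |η ^ 2| * (g * g) := by
        refine (frob_smul_add_smul_add_smul_le _ _ _ _ _ _).trans ?_
        rw [← hd]
        gcongr
    _ = (1 - η) * d + η * (d * d) + η ^ 2 * (g * g) := by
        rw [abs_of_nonneg (sub_nonneg.2 hη1), abs_neg, abs_of_pos hη0, abs_of_nonneg (sq_nonneg η)]
    _ ≤ ε := by linarith
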